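/- arXiv:2601.10262 — 2 statements merged into one kernel-verified Lean document; each statement's English description precedes it below -/
import Mathlib

section
/- Let P be an N×N upper triangular matrix over 𝔽₂ with all diagonal entries equal to 1 and let A ⊆ {0,…,N−1}. Then the dual of the upper polynomial polar code C_{P·G_N}(A) is C_{P·G_N}(A)^⊥ = C_{(P^t)^{−1}·G_N·Q_π·G_N}(Aᶜ), where Aᶜ = {0,…,N−1} ∖ A. -/
open Matrix

/-- The set of positions of nonzero bits (within `{0,…,m−1}`) of the binary expansion of `i`. -/
def bsupp (m i : ℕ) : Finset ℕ := (Finset.range m).filter fun k => i.testBit k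

/-- The polar transform matrix `G_N`, `N = 2^m`: entry `(i,j)` is `1` iff `supp j ⊆ supp i`. -/
def GN (m : ℕ) : Matrix (Fin (2^m)) (Fin (2^m)) (ZMod 2) :=
  fun i j => if bsupp m (j : ℕ) ⊆ bsupp m (i : ℕ) then 1 else 0

/-- The permutation matrix swapping `i` and `N−1−i`. -/
def Qpi (m : ℕ) : Matrix (Fin (2^m)) (Fin (2^m)) (ZMod 2) :=
  fun i j => if (j : ℕ) = 2^m - 1 - (i : ℕ) then 1 else 0

/-- The linear code spanned by the rows of `B` with index in `A`. -/
def code {N : ℕ} (B : Matrix (Fin N) (Fin N) (ZMod 2)) (A : Set (Fin N)) :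
    Submodule (ZMod 2) (Fin N → ZMod 2) :=
  Submodule.span (ZMod 2) ((fun i => B i) '' A)

/-- The dual code of a linear code `C ⊆ 𝔽₂^N`. -/
def dualCode {N : ℕ} (C : Submodule (ZMod 2) (Fin N → ZMod 2)) :
    Submodule (ZMod 2) (Fin N → ZMod 2) where
  carrier := {v | ∀ c ∈ C, ∑ k, v k * c k = 0}
  zero_mem' := by intro c hc; simp
  add_mem' := by
    intro a b ha hb c hc
    have h1 := ha c hc
    have h2 := hb c hc
    simp only [Pi.add_apply, add_mul, Finset.sum_add_distrib, h1, h2, add_zero]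
  smul_mem' := by
    intro r v hv c hc
    have h := hv c hc
    simp only [Pi.smul_apply, smul_eq_mul, mul_assoc, ← Finset.mul_sum, h, mul_zero]

theorem bsupp_injective (m : ℕ) : Function.Injective fun k : Fin (2 ^ m) => bsupp m k := by
  intro a b h
  apply Fin.ext
  apply Nat.eq_of_testBit_eq
  intro t
  by_cases ht : t < m
  · have := Finset.ext_iff.1 h t
    simp only [bsupp, Finset.mem_filter, Finset.mem_range, ht, true_and] at this
    exact Bool.eq_iff_iff.2 this
  · have hle : 2 ^ m ≤ 2 ^ t := Nat.pow_le_pow_right (by norm_num) (not_lt.1 ht)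
    rw [Nat.testBit_lt_two_pow (a.2.trans_le hle), Nat.testBit_lt_two_pow (b.2.trans_le hle)]

theorem bsupp_subset_range (m i : ℕ) : bsupp m i ⊆ Finset.range m := Finset.filter_subset _ _

theorem image_bsupp (m : ℕ) :
    Finset.univ.image (fun k : Fin (2 ^ m) => bsupp m k) = (Finset.range m).powerset := by
  apply Finset.eq_of_subset_of_card_le
  · intro s hs
    obtain ⟨k, -, rfl⟩ := Finset.mem_image.1 hs
    exact Finset.mem_powerset.2 (bsupp_subset_range m k)
  · rw [Finset.card_image_of_injective _ (bsupp_injective m)]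
    simp

/-- Summing over indices amounts to summing over subsets of `{0,…,m−1}`. -/
theorem sum_bsupp {M : Type*} [AddCommMonoid M] (m : ℕ) (f : Finset ℕ → M) :
    ∑ k : Fin (2 ^ m), f (bsupp m k) = ∑ s ∈ (Finset.range m).powerset, f s := by
  rw [← image_bsupp, Finset.sum_image (bsupp_injective m).injOn]

theorem bsupp_compl (m : ℕ) (i : Fin (2 ^ m)) :
    bsupp m (2 ^ m - 1 - i) = Finset.range m \ bsupp m i := by
  ext t
  have h : 2 ^ m - 1 - (i : ℕ) = 2 ^ m - (i + 1) := by omega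
  simp only [bsupp, h, Nat.testBit_two_pow_sub_succ i.2, Finset.mem_filter, Finset.mem_range,
    Finset.mem_sdiff]
  by_cases ht : t < m <;> simp [ht]

theorem two_pow_zmod_two (n : ℕ) : ((2 ^ n : ℕ) : ZMod 2) = if n = 0 then 1 else 0 := by
  have h2 : (2 : ZMod 2) = 0 := rfl
  rcases eq_or_ne n 0 with rfl | hn
  · simp
  · simp [hn, h2]

theorem GN_mul_self (m : ℕ) : GN m * GN m = 1 := by
  ext i j
  rw [Matrix.mul_apply]
  simp only [GN, ← ite_and, mul_ite, mul_one, mul_zero]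
  rw [sum_bsupp m fun s => if bsupp m j ⊆ s ∧ s ⊆ bsupp m i then (1 : ZMod 2) else 0,
    Finset.sum_boole]
  have hset : (Finset.range m).powerset.filter (fun s => bsupp m j ⊆ s ∧ s ⊆ bsupp m i) =
      Finset.Icc (bsupp m j) (bsupp m i) := by
    ext s
    simp only [Finset.mem_filter, Finset.mem_powerset, Finset.mem_Icc,
      and_iff_right_iff_imp]
    exact fun h => h.2.trans (bsupp_subset_range m i)
  rw [hset, Matrix.one_apply]
  by_cases hji : bsupp m j ⊆ bsupp m i
  · rw [Finset.card_Icc_finset hji, two_pow_zmod_two]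
    refine if_congr ⟨fun h => ?_, fun h => by simp [h]⟩ rfl rfl
    exact (bsupp_injective m (Finset.eq_of_subset_of_card_le hji (Nat.sub_eq_zero_iff_le.1 h))).symm
  · have hne : i ≠ j := by
      rintro rfl
      exact hji subset_rfl
    rw [Finset.Icc_eq_empty hji, if_neg hne]
    simp

theorem Qpi_mul_GN_apply (m : ℕ) (i j : Fin (2 ^ m)) :
    (Qpi m * GN m) i j = if bsupp m j ⊆ Finset.range m \ bsupp m i then 1 else 0 := by
  have hrev : ∀ k : Fin (2 ^ m), (k : ℕ) = 2 ^ m - 1 - (i : ℕ) ↔ k = i.rev := by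
    intro k
    rw [Fin.ext_iff, Fin.val_rev, show 2 ^ m - 1 - (i : ℕ) = 2 ^ m - (i + 1) by omega]
  have hval : ((i.rev : Fin (2 ^ m)) : ℕ) = 2 ^ m - 1 - (i : ℕ) := (hrev _).2 rfl
  simp only [Matrix.mul_apply, Qpi, hrev, ite_mul, one_mul, zero_mul, Finset.sum_ite_eq',
    Finset.mem_univ, if_true, GN, hval, bsupp_compl]

theorem GN_mul_Qpi_mul_GN (m : ℕ) : GN m * Qpi m * GN m = (GN m)ᵀ := by
  ext i j
  rw [Matrix.mul_assoc, Matrix.mul_apply]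
  simp only [Qpi_mul_GN_apply]
  simp only [GN, Matrix.transpose_apply, ← ite_and, mul_ite, mul_one, mul_zero]
  rw [sum_bsupp m fun s =>
      if bsupp m j ⊆ Finset.range m \ s ∧ s ⊆ bsupp m i then (1 : ZMod 2) else 0,
    Finset.sum_boole]
  have hset : (Finset.range m).powerset.filter
      (fun s => bsupp m j ⊆ Finset.range m \ s ∧ s ⊆ bsupp m i) =
      (bsupp m i \ bsupp m j).powerset := by
    ext s
    have hi := bsupp_subset_range m i
    have hj := bsupp_subset_range m j
    simp only [Finset.mem_filter, Finset.mem_powerset, Finset.subset_sdiff]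
    exact ⟨fun h => ⟨h.2.2, h.2.1.2.symm⟩, fun h => ⟨h.1.trans hi, ⟨hj, h.2.symm⟩, h.1⟩⟩
  rw [hset, Finset.card_powerset, two_pow_zmod_two]
  simp only [Finset.card_eq_zero, Finset.sdiff_eq_empty_iff_subset]

/-- The dual of a code spanned by rows of an invertible matrix is spanned by the complementary
rows of the inverse transpose. -/
theorem dualCode_code {N : ℕ} {B D : Matrix (Fin N) (Fin N) (ZMod 2)} (h : D * Bᵀ = 1)
    (A : Set (Fin N)) : dualCode (code B A) = code D Aᶜ := by
  apply le_antisymm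
  · intro v hv
    have hexp : v = ∑ j, (v ⬝ᵥ B j) • D j := by
      have h' : v ᵥ* (Bᵀ * D) = v := by rw [mul_eq_one_comm.1 h, Matrix.vecMul_one]
      rw [← Matrix.vecMul_vecMul, Matrix.vecMul_eq_sum] at h'
      exact h'.symm
    rw [hexp]
    refine Submodule.sum_mem _ fun j _ => ?_
    by_cases hj : j ∈ A
    · have hzero : v ⬝ᵥ B j = 0 := hv (B j) (Submodule.subset_span ⟨j, hj, rfl⟩)
      simp [hzero]
    · exact Submodule.smul_mem _ _ (Submodule.subset_span ⟨j, hj, rfl⟩)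
  · refine Submodule.span_le.2 ?_
    rintro _ ⟨j, hj, rfl⟩ c hc
    change D j ⬝ᵥ c = 0
    induction hc using Submodule.span_induction with
    | mem x hx =>
      obtain ⟨i, hi, rfl⟩ := hx
      have hne : j ≠ i := fun e => hj (e ▸ hi)
      have hji := congrFun (congrFun h j) i
      rwa [Matrix.one_apply_ne hne] at hji
    | zero => simp
    | add x y _ _ hx hy => rw [dotProduct_add, hx, hy, add_zero]
    | smul a x _ hx => rw [dotProduct_smul, hx, smul_zero]

/-- let `P` be an `N×N` upper triangular matrix over `𝔽₂` with unit diagonal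
and `A ⊆ {0,…,N−1}`.  Then the dual of the upper polynomial polar code `C_{P·G_N}(A)` is
`C_{(Pᵗ)⁻¹·G_N·Q_π·G_N}(Aᶜ)`. -/
theorem stmt9 (m : ℕ) (hm : 0 < m)
    (P : Matrix (Fin (2^m)) (Fin (2^m)) (ZMod 2))
    (hupper : ∀ i j : Fin (2^m), j < i → P i j = 0)
    (hdiag : ∀ i : Fin (2^m), P i i = 1)
    (A : Set (Fin (2^m))) :
    dualCode (code (P * GN m) A) = code ((Pᵀ)⁻¹ * GN m * Qpi m * GN m) Aᶜ := by
  apply dualCode_code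
  have hdet : P.det = 1 := by
    rw [Matrix.det_of_isUpperTriangular fun i j hij => hupper i j hij]
    simp [hdiag]
  have hunit : IsUnit (Pᵀ).det := by simp [hdet]
  have hGG : (GN m)ᵀ * (GN m)ᵀ = 1 := by
    rw [← Matrix.transpose_mul, GN_mul_self, Matrix.transpose_one]
  calc (Pᵀ)⁻¹ * GN m * Qpi m * GN m * (P * GN m)ᵀ
      = (Pᵀ)⁻¹ * (GN m * Qpi m * GN m * (GN m)ᵀ) * Pᵀ := by
        simp only [Matrix.transpose_mul, Matrix.mul_assoc]
    _ = 1 := by rw [GN_mul_Qpi_mul_GN, hGG, Matrix.mul_one, Matrix.nonsing_inv_mul _ hunit]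
end

section
/- Let P be an N×N upper triangular matrix over 𝔽₂ with all diagonal entries equal to 1 and let A ⊆ {0,…,N−1} be nonempty with nonempty complement Aᶜ. Then the dual of the upper polynomial polar code is sandwiched between two decreasing monomial codes: C_{G_N}({N−min(A),…,N−1}) ⊆ C_{P·G_N}(A)^⊥ ⊆ C_{G_N}({N−1−max(Aᶜ),…,N−1}). -/
open Matrix

lemma mem_bsupp {m i k : ℕ} : k ∈ bsupp m i ↔ k < m ∧ i.testBit k = true := by
  simp [bsupp]

lemma le_of_bsupp_subset {m i j : ℕ} (hj : j < 2 ^ m) (h : bsupp m j ⊆ bsupp m i) :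
    j ≤ i := by
  have hand : j &&& i = j := by
    apply Nat.eq_of_testBit_eq
    intro k
    rw [Nat.testBit_and]
    cases hk : j.testBit k with
    | false => simp
    | true =>
      have hkm : k < m := by
        by_contra hkm
        have hlt : j < 2 ^ k := hj.trans_le (Nat.pow_le_pow_right two_pos (not_lt.mp hkm))
        simp [Nat.testBit_lt_two_pow hlt] at hk
      simpa using (mem_bsupp.mp (h (mem_bsupp.mpr ⟨hkm, hk⟩))).2
  exact hand ▸ Nat.and_le_right

lemma mem_bsupp_compl {m i k : ℕ} (hi : i < 2 ^ m) :
    k ∈ bsupp m (2 ^ m - 1 - i) ↔ k < m ∧ k ∉ bsupp m i := by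
  have hsub : 2 ^ m - 1 - i = 2 ^ m - (i + 1) := by omega
  rw [mem_bsupp, mem_bsupp, hsub, Nat.testBit_two_pow_sub_succ hi]
  simp +contextual

/-- Two indices whose sum is at least `2 ^ m` share a nonzero bit. -/
lemma exists_mem_bsupp_inter {m i j : ℕ} (hi : i < 2 ^ m) (hj : j < 2 ^ m)
    (hij : 2 ^ m ≤ i + j) : ∃ t, t ∈ bsupp m i ∧ t ∈ bsupp m j := by
  by_contra! hdis
  have hsub : bsupp m i ⊆ bsupp m (2 ^ m - 1 - j) := fun t ht =>
    (mem_bsupp_compl hj).mpr ⟨(mem_bsupp.mp ht).1, hdis t ht⟩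
  have := le_of_bsupp_subset hi hsub
  omega

lemma bsupp_xor_two_pow_subset {m k t : ℕ} {s : Finset ℕ} (ht : t ∈ s)
    (h : bsupp m k ⊆ s) : bsupp m (k ^^^ 2 ^ t) ⊆ s := by
  intro r hr
  by_cases hrt : t = r
  · exact hrt ▸ ht
  · rw [mem_bsupp] at hr
    exact h (mem_bsupp.mpr (by simpa [Nat.testBit_two_pow, hrt] using hr))

lemma bsupp_xor_two_pow_subset_iff {m k t : ℕ} {s : Finset ℕ} (ht : t ∈ s) :
    bsupp m (k ^^^ 2 ^ t) ⊆ s ↔ bsupp m k ⊆ s := by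
  refine ⟨fun h => ?_, bsupp_xor_two_pow_subset ht⟩
  simpa [Nat.xor_assoc] using bsupp_xor_two_pow_subset ht h

/-- Rows of `G_N` whose indices sum to at least `N` are orthogonal. -/
lemma GN_row_orthogonal {m : ℕ} (i j : Fin (2 ^ m)) (hij : 2 ^ m ≤ (i : ℕ) + j) :
    GN m i ⬝ᵥ GN m j = 0 := by
  obtain ⟨t, hti, htj⟩ := exists_mem_bsupp_inter i.2 j.2 hij
  have hlt : ∀ k : Fin (2 ^ m), (k : ℕ) ^^^ 2 ^ t < 2 ^ m := fun k =>
    Nat.xor_lt_two_pow k.2 (Nat.pow_lt_pow_right one_lt_two (mem_bsupp.mp hti).1)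
  refine Finset.sum_involution (fun k _ => ⟨(k : ℕ) ^^^ 2 ^ t, hlt k⟩) ?_ ?_ ?_ ?_
  · intro k _
    simp only [GN, bsupp_xor_two_pow_subset_iff hti, bsupp_xor_two_pow_subset_iff htj]
    exact CharTwo.add_self_eq_zero _
  · intro k _ _ hk
    have hval : (k : ℕ) ^^^ 2 ^ t = k := congrArg Fin.val hk
    have hbit := congrArg (Nat.testBit · t) hval
    simp at hbit
  · simp
  · simp

/-- Rows of `G_N` whose indices sum to `N - 1` have inner product `1`. -/
lemma GN_row_dotProduct_compl {m : ℕ} (i j : Fin (2 ^ m))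
    (hij : (i : ℕ) + j = 2 ^ m - 1) : GN m i ⬝ᵥ GN m j = 1 := by
  have hj : (j : ℕ) = 2 ^ m - 1 - i := by omega
  have hempty : bsupp m 0 = ∅ := by simp [bsupp]
  rw [dotProduct, Finset.sum_eq_single ⟨0, Nat.two_pow_pos m⟩]
  · simp [GN, hempty]
  · intro k _ hk
    by_contra hne
    have hsub : bsupp m k ⊆ bsupp m i ∧ bsupp m k ⊆ bsupp m j := by
      simpa [GN, and_comm] using hne
    have hk0 : bsupp m k ⊆ bsupp m 0 := fun t ht =>
      absurd (hsub.1 ht) ((mem_bsupp_compl i.2).mp (hj ▸ hsub.2 ht)).2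
    exact hk (Fin.ext (Nat.le_zero.mp (le_of_bsupp_subset k.2 hk0)))
  · simp

lemma isUnit_GN (m : ℕ) : IsUnit (GN m) := by
  rw [Matrix.isUnit_iff_isUnit_det, Matrix.det_of_isLowerTriangular]
  · simp [GN]
  · intro i j hij
    have hlt : i < j := hij
    exact if_neg fun h => absurd (le_of_bsupp_subset j.2 h) (by simpa using hlt)

lemma mem_dualCode_code {N : ℕ} {B : Matrix (Fin N) (Fin N) (ZMod 2)} {A : Set (Fin N)}
    {v : Fin N → ZMod 2} : v ∈ dualCode (code B A) ↔ ∀ a ∈ A, v ⬝ᵥ B a = 0 := by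
  refine ⟨fun h a ha => h _ (Submodule.subset_span ⟨a, ha, rfl⟩), fun h c hc => ?_⟩
  change v ⬝ᵥ c = 0
  induction hc using Submodule.span_induction with
  | mem x hx => obtain ⟨a, ha, rfl⟩ := hx; exact h a ha
  | zero => simp
  | add x y _ _ hx hy => rw [dotProduct_add, hx, hy, add_zero]
  | smul r x _ hx => rw [dotProduct_smul, hx, smul_zero]

lemma dotProduct_mul_row {N : ℕ} (P G : Matrix (Fin N) (Fin N) (ZMod 2))
    (v : Fin N → ZMod 2) (a : Fin N) :
    v ⬝ᵥ (P * G) a = ∑ k, P a k * (v ⬝ᵥ G k) := by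
  rw [Matrix.mul_apply_eq_vecMul, Matrix.vecMul_eq_sum, dotProduct_sum]
  simp [dotProduct_smul]

/-- Orthogonality to the rows of `P * G` above index `M` passes to the rows of `G`. -/
lemma dotProduct_row_eq_zero_of_upper {N : ℕ} {P G : Matrix (Fin N) (Fin N) (ZMod 2)}
    (hupper : ∀ i j, j < i → P i j = 0) (hdiag : ∀ i, P i i = 1)
    {v : Fin N → ZMod 2} {M : Fin N} (hv : ∀ a, M < a → v ⬝ᵥ (P * G) a = 0) (a : Fin N)
    (ha : M < a) : v ⬝ᵥ G a = 0 := by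
  induction a using WellFoundedGT.induction with
  | ind a ih =>
    have h := hv a ha
    rw [dotProduct_mul_row, Finset.sum_eq_single a, hdiag, one_mul] at h
    · exact h
    · intro k _ hk
      rcases lt_or_gt_of_ne hk with hlt | hgt
      · rw [hupper a k hlt, zero_mul]
      · rw [ih k hgt (ha.trans hgt), mul_zero]
    · simp

/-- A word orthogonal to all rows of `G_N` above index `M` only involves rows from `N - 1 - M` on. -/
lemma mem_code_GN_of_orthogonal {m : ℕ} {v : Fin (2 ^ m) → ZMod 2} {M : Fin (2 ^ m)}
    (hv : ∀ k, M < k → v ⬝ᵥ GN m k = 0) :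
    v ∈ code (GN m) {i : Fin (2 ^ m) | 2 ^ m - 1 - (M : ℕ) ≤ (i : ℕ)} := by
  obtain ⟨c, rfl⟩ := (Matrix.vecMul_surjective_iff_isUnit.mpr (isUnit_GN m)) v
  simp only [Matrix.vecMul_eq_sum, sum_dotProduct, smul_dotProduct, smul_eq_mul] at hv
  have hzero : ∀ i : Fin (2 ^ m), (i : ℕ) < 2 ^ m - 1 - M → c i = 0 := by
    intro i
    induction i using WellFoundedLT.induction with
    | ind i ih =>
      intro hi
      have h := hv ⟨2 ^ m - 1 - i, by omega⟩ (Fin.lt_def.mpr (by simp only; omega))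
      rw [Finset.sum_eq_single i, GN_row_dotProduct_compl _ _ (by simp only; omega),
        mul_one] at h
      · exact h
      · intro k _ hk
        rcases lt_or_gt_of_ne hk with hlt | hgt
        · rw [ih k hlt ((Fin.lt_def.mp hlt).trans hi), zero_mul]
        · rw [GN_row_orthogonal _ _ (by have := Fin.lt_def.mp hgt; simp only; omega), mul_zero]
      · simp
  simp only [Matrix.vecMul_eq_sum]
  refine Submodule.sum_mem _ fun i _ => ?_
  by_cases hi : (i : ℕ) < 2 ^ m - 1 - M
  · rw [hzero i hi, zero_smul]
    exact Submodule.zero_mem _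
  · exact Submodule.smul_mem _ _ (Submodule.subset_span ⟨i, not_lt.mp hi, rfl⟩)

/-- let `P` be upper triangular with unit diagonal over `𝔽₂` and let
`A ⊆ {0,…,N−1}` be nonempty with nonempty complement.  Then the dual of the upper polynomial
polar code is sandwiched between two decreasing monomial codes:
`C_{G_N}({N−min(A),…,N−1}) ⊆ C_{P·G_N}(A)^⊥ ⊆ C_{G_N}({N−1−max(Aᶜ),…,N−1})`. -/
theorem stmt14 (m : ℕ) (hm : 0 < m)
    (P : Matrix (Fin (2^m)) (Fin (2^m)) (ZMod 2))
    (hupper : ∀ i j : Fin (2^m), j < i → P i j = 0)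
    (hdiag : ∀ i : Fin (2^m), P i i = 1)
    (A : Finset (Fin (2^m))) (hA : A.Nonempty) (hc : Aᶜ.Nonempty) :
    code (GN m) {i : Fin (2^m) | 2^m - (A.min' hA : ℕ) ≤ (i : ℕ)}
        ≤ dualCode (code (P * GN m) ↑A)
    ∧ dualCode (code (P * GN m) ↑A)
        ≤ code (GN m) {i : Fin (2^m) | 2^m - 1 - (Aᶜ.max' hc : ℕ) ≤ (i : ℕ)} := by
  constructor
  · refine Submodule.span_le.mpr ?_
    rintro _ ⟨i, hi, rfl⟩
    refine mem_dualCode_code.mpr fun a ha => ?_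
    rw [dotProduct_mul_row]
    refine Finset.sum_eq_zero fun k _ => ?_
    rcases lt_or_ge k a with hlt | hge
    · rw [hupper a k hlt, zero_mul]
    · have hmin : A.min' hA ≤ k := (A.min'_le a ha).trans hge
      have hsum : 2 ^ m ≤ (i : ℕ) + k := by
        have := Fin.le_def.mp hmin
        have hi' : 2 ^ m - (A.min' hA : ℕ) ≤ i := hi
        omega
      rw [GN_row_orthogonal i k hsum, mul_zero]
  · intro v hv
    rw [mem_dualCode_code] at hv
    refine mem_code_GN_of_orthogonal
      (dotProduct_row_eq_zero_of_upper hupper hdiag fun a ha => hv a ?_)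
    by_contra hmem
    exact absurd (Aᶜ.le_max' a (Finset.mem_compl.mpr hmem)) (not_le.mpr ha)
end
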